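/- arXiv:2210.06279 — 2 statements merged into one kernel-verified Lean document; each statement's English description precedes it below -/
import Mathlib

section
/- Let C be a diamond category and W a formation of finite complexity k. Suppose R₀,…,R_k ∈ W with semisimple epimorphisms ρ_i: R_i → R_{i−1} for 1 ≤ i ≤ k, F ∈ W, and φ ∈ Epi(F, R_k). If φ, ρ_k, …, ρ_1 is a radical sequence, then φ is an isomorphism. -/
open CategoryTheory Opposite Filter Topology MeasureTheory
open scoped ENNReal Classical

universe u

namespace MomentCat

variable {C : Type u} [SmallCategory C]

/-- The poset of isomorphism classes of quotient objects of `G`,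
realized as subobjects of `op G` in `Cᵒᵖ`.  The order is: `a ≤ b` iff `a` is a
further quotient of `b`, so that `⊤` is the class of the identity `G → G`. -/
abbrev Quotients (G : C) := Subobject (op G)

/-- The join of two quotient classes (the least upper bound, when it exists). -/
noncomputable def qSup {G : C} (a b : Quotients G) : Quotients G :=
  if h : ∃ c, IsLUB {a, b} c then h.choose else a

/-- The meet of two quotient classes (the greatest lower bound, when it exists). -/
noncomputable def qInf {G : C} (a b : Quotients G) : Quotients G :=
  if h : ∃ c, IsGLB {a, b} c then h.choose else a

/-- The join of a set of quotient classes (when it exists). -/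
noncomputable def qsSup {G : C} (s : Set (Quotients G)) : Quotients G :=
  if h : ∃ c, IsLUB s c then h.choose else ⊤

/-- The quotient class determined by an epimorphism `π : G ⟶ F`. -/
noncomputable def quotOf {G F : C} (π : G ⟶ F) (h : Epi π) : Quotients G :=
  haveI := h
  Subobject.mk π.op

/-- The underlying object of a quotient class. -/
noncomputable def qObj {G : C} (a : Quotients G) : C :=
  unop (Subobject.underlying.obj a)

/-- An object is minimal if its only quotient is itself. -/
def IsMinimalObj (G : C) : Prop := Subsingleton (Quotients G)

/-- An epimorphism is simple if it is not an isomorphism and the interval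
`[F, G]` contains only the two endpoints. -/
def IsSimpleEpi {G F : C} (π : G ⟶ F) : Prop :=
  ∃ h : Epi π, ¬IsIso π ∧ ∀ X : Quotients G, quotOf π h ≤ X → X = quotOf π h ∨ X = ⊤

/-- The interval `[a, ⊤]` is a complemented lattice. -/
def IntervalComplTop {G : C} (a : Quotients G) : Prop :=
  ∀ X : Quotients G, a ≤ X → ∃ Y : Quotients G, a ≤ Y ∧ qSup X Y = ⊤ ∧ qInf X Y = a

/-- The interval `[a, b]` is a complemented lattice. -/
def IntervalCompl {G : C} (a b : Quotients G) : Prop :=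
  ∀ X : Quotients G, a ≤ X → X ≤ b →
    ∃ Y : Quotients G, a ≤ Y ∧ Y ≤ b ∧ qSup X Y = b ∧ qInf X Y = a

/-- An epimorphism `π : G ⟶ F` is semisimple if the interval `[F,G]` is complemented. -/
def IsSemisimpleEpi {G F : C} (π : G ⟶ F) : Prop :=
  ∃ h : Epi π, IntervalComplTop (quotOf π h)

/-- A set of objects (stable under isomorphism) closed under quotients. -/
def DownwardClosed (S : Set C) : Prop :=
  ∀ G ∈ S, ∀ (F : C) (π : G ⟶ F), Epi π → F ∈ S

/-- A set of objects closed under joins of quotients of a common object. -/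
def JoinClosed (S : Set C) : Prop :=
  ∀ (G : C) (a b : Quotients G), qObj a ∈ S → qObj b ∈ S →
    (∃ c, IsLUB {a, b} c) → qObj (qSup a b) ∈ S

/-- A set of objects containing all minimal objects. -/
def MinClosed (S : Set C) : Prop := ∀ G : C, IsMinimalObj G → G ∈ S

/-- A formation: downward-closed, join-closed, containing all minimal objects. -/
def IsFormation (S : Set C) : Prop := DownwardClosed S ∧ JoinClosed S ∧ MinClosed S

/-- The smallest downward-closed join-closed set containing `B` and all minimal objects. -/
def levelGen (B : Set C) : Set C := ⋂₀ {S : Set C | IsFormation S ∧ B ⊆ S}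

/-- A level is a formation generated by a finite set of objects. -/
def IsLevel (S : Set C) : Prop := ∃ B : Set C, B.Finite ∧ S = levelGen B

/-- The type of isomorphism classes of objects of `C`. -/
abbrev IsoCls (C : Type u) [SmallCategory C] := Quotient (CategoryTheory.isIsomorphicSetoid C)

/-- The isomorphism class of an object. -/
def cls (G : C) : IsoCls C := Quotient.mk (CategoryTheory.isIsomorphicSetoid C) G

/-- The set of epimorphisms from `G` to `F`. -/
abbrev Epis (G F : C) := {π : G ⟶ F // Epi π}

/-- There is a chain of covers of length `d` from `a` to `b` (i.e. the morphism
`qObj b → qObj a` has dimension `d`). -/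
def CovChain {G : C} (a b : Quotients G) (d : ℕ) : Prop :=
  ∃ c : Fin (d + 1) → Quotients G, c 0 = a ∧ c (Fin.last d) = b ∧
    ∀ i : Fin d, c i.castSucc ⋖ c i.succ

/-- An epimorphism has dimension `d`. -/
def EpiDim {G F : C} (π : G ⟶ F) (h : Epi π) (d : ℕ) : Prop :=
  CovChain (quotOf π h) ⊤ d

/-- A set of isomorphism classes is narrow if each of its members receives simple
epimorphisms from only finitely many of its members (up to isomorphism). -/
def Narrow (S : Set C) : Prop :=
  ∀ G ∈ S, {X : IsoCls C | X.out ∈ S ∧ ∃ π : X.out ⟶ G, IsSimpleEpi π}.Finite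

/-- The minimal quotient: the bottom of the quotient poset, when it exists. -/
noncomputable def qBot (G : C) : Quotients G :=
  if h : ∃ b : Quotients G, ∀ x, b ≤ x then h.choose else ⊤

/-- `G` has complexity at most `k`: the map to the minimal quotient is a
composition of `k` semisimple epimorphisms. -/
def complexityLE (G : C) (k : ℕ) : Prop :=
  ∃ c : Fin (k + 1) → Quotients G, c 0 = qBot G ∧ c (Fin.last k) = ⊤ ∧
    ∀ i : Fin k, c i.castSucc ≤ c i.succ ∧ IntervalCompl (c i.castSucc) (c i.succ)

/-- A diamond category. -/
structure IsDiamond (C : Type u) [SmallCategory C] : Prop where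
  /-- quotient posets are finite … -/
  quotFinite : ∀ G : C, Finite (Quotients G)
  /-- … and are lattices: all pairwise joins exist … -/
  lub : ∀ (G : C) (a b : Quotients G), ∃ c, IsLUB {a, b} c
  /-- … and all pairwise meets exist … -/
  glb : ∀ (G : C) (a b : Quotients G), ∃ c, IsGLB {a, b} c
  /-- … and are modular. -/
  modular : ∀ (G : C) (a b x : Quotients G), a ≤ b →
    qSup a (qInf x b) = qInf (qSup a x) b
  /-- automorphism groups are finite -/
  autFinite : ∀ G : C, Finite (Aut G)
  /-- levels are narrow -/
  levelNarrow : ∀ S : Set C, IsLevel S → Narrow S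
  /-- countably many isomorphism classes of minimal objects -/
  minCountable : Set.Countable {X : IsoCls C | IsMinimalObj X.out}

/-- A family assigning to each object the Möbius function of its quotient poset:
`mob G x x = 1` and for `x < y`, `∑_{x ≤ z ≤ y} mob G x z = 0`. -/
def IsMobiusFamily (mob : ∀ G : C, Quotients G → Quotients G → ℝ) : Prop :=
  ∀ G : C, (∀ x : Quotients G, mob G x x = 1) ∧
    ∀ x y : Quotients G, x < y → ∑ᶠ z ∈ Set.Icc x y, mob G x z = 0

/-- `μ(π) = μ(F, G)` for an epimorphism `π : G ⟶ F`. -/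
noncomputable def muEpi (mob : ∀ G : C, Quotients G → Quotients G → ℝ)
    {G F : C} (π : G ⟶ F) (h : Epi π) : ℝ :=
  mob G (quotOf π h) ⊤

/-- `μ̂(F,G) = ∑_{π ∈ Epi(G,F)/Aut(F)} μ(π) = (∑_{π ∈ Epi(G,F)} μ(π))/|Aut F|`
(the `Aut F`-action on epimorphisms being free). -/
noncomputable def muHat (mob : ∀ G : C, Quotients G → Quotients G → ℝ) (F G : C) : ℝ :=
  (∑' π : Epis G F, muEpi mob π.1 π.2) / (Nat.card (Aut F) : ℝ)

/-- `S_{G,F} = |Epi(G,F)|/|Aut F|`. -/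
noncomputable def SQ (G F : C) : ℝ :=
  (Nat.card (Epis G F) : ℝ) / (Nat.card (Aut F) : ℝ)

/-- `T_{G,F} = μ̂(F,G)`. -/
noncomputable def TQ (mob : ∀ G : C, Quotients G → Quotients G → ℝ) (G F : C) : ℝ :=
  muHat mob F G

/-- `Z(π)`: the number of `H ∈ [F,G]` satisfying the distributive law. -/
noncomputable def Zfn {G F : C} (π : G ⟶ F) (h : Epi π) : ℕ :=
  Nat.card {H : Quotients G // quotOf π h ≤ H ∧ ∀ K₁ K₂ : Quotients G,
    quotOf π h ≤ K₁ → quotOf π h ≤ K₂ →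
      qSup H (qInf K₁ K₂) = qInf (qSup H K₁) (qSup H K₂)}

/-- The isomorphism classes lying in `W`. -/
abbrev WSub (W : Set C) := {X : IsoCls C // X.out ∈ W}

/-- `(M_G)` is well-behaved at `W`:
`∑_{G ∈ W} ∑_{π ∈ Epi(G,F)} (|μ(F,G)|/|Aut G|) Z(π)³ |M_G| < ∞` for every `F ∈ W`. -/
def WellBehavedAt (mob : ∀ G : C, Quotients G → Quotients G → ℝ) (M : IsoCls C → ℝ)
    (W : Set C) : Prop :=
  ∀ F : C, F ∈ W → Summable (fun q : Σ X : WSub W, Epis X.1.out F =>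
    |mob q.1.1.out (quotOf q.2.1 q.2.2) ⊤| / (Nat.card (Aut q.1.1.out) : ℝ)
      * ((Zfn q.2.1 q.2.2 : ℝ)) ^ 3 * |M q.1.1|)

/-- The `W`-quotient `G^W`: the join of all quotients of `G` lying in `W`. -/
noncomputable def wQuot (W : Set C) (G : C) : Quotients G :=
  qsSup {a : Quotients G | qObj a ∈ W}

/-- An epimorphism `φ : G ⟶ E` is relative-`W` if `G → G^W ∨ E` is an isomorphism. -/
def RelativeW (W : Set C) {G E : C} (φ : G ⟶ E) (h : Epi φ) : Prop :=
  qSup (wQuot W G) (quotOf φ h) = ⊤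

/-- `v_{W,F} = ∑_{G ∈ W} μ̂(F,G) M_G / |Aut G|`. -/
noncomputable def vWF (mob : ∀ G : C, Quotients G → Quotients G → ℝ) (M : IsoCls C → ℝ)
    (W : Set C) (F : C) : ℝ :=
  ∑' X : WSub W, muHat mob F X.1.out * M X.1 / (Nat.card (Aut X.1.out) : ℝ)

theorem epiComp {G F E : C} {π : G ⟶ F} {ρ : F ⟶ E} (h1 : Epi π) (h2 : Epi ρ) :
    Epi (π ≫ ρ) := by
  haveI := h1; haveI := h2; infer_instance

/-- The radical of an epimorphism with class `a`: the join of all minimal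
elements of `[a, ⊤]` distinct from `a` (together with `a` itself). -/
noncomputable def radicalEl {G : C} (a : Quotients G) : Quotients G :=
  qsSup (insert a {X : Quotients G | a ⋖ X})

end MomentCat

namespace MomentCat

theorem aux_qSup {C : Type u} [SmallCategory C] (hC : IsDiamond C) {G : C} (a b : Quotients G) :
    IsLUB {a, b} (qSup a b) := by
  unfold qSup
  rw [dif_pos (hC.lub G a b)]
  exact (hC.lub G a b).choose_spec

theorem aux_qInf {C : Type u} [SmallCategory C] (hC : IsDiamond C) {G : C} (a b : Quotients G) :
    IsGLB {a, b} (qInf a b) := by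
  unfold qInf
  rw [dif_pos (hC.glb G a b)]
  exact (hC.glb G a b).choose_spec

theorem aux_rad {C : Type u} [SmallCategory C] {G : C} (a : Quotients G) :
    radicalEl a ∈ upperBounds (insert a {X : Quotients G | a ⋖ X}) := by
  unfold radicalEl qsSup
  split_ifs with h
  · exact h.choose_spec.1
  · intro x _
    exact le_top

theorem aux_bot {C : Type u} [SmallCategory C] (hC : IsDiamond C) {G : C} (x : Quotients G) :
    qBot G ≤ x := by
  have h : ∃ b : Quotients G, ∀ x, b ≤ x := by
    haveI := hC.quotFinite G
    obtain ⟨m, hm⟩ := (Set.toFinite (Set.univ : Set (Quotients G))).exists_minimal ⟨⊤, trivial⟩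
    refine ⟨m, fun x => ?_⟩
    have h1 := aux_qInf hC m x
    have h2 : qInf m x ≤ m := h1.1 (by simp)
    exact (hm.2 trivial h2).trans (h1.1 (by simp))
  unfold qBot
  rw [dif_pos h]
  exact h.choose_spec x

theorem aux_step {C : Type u} [SmallCategory C] (hC : IsDiamond C) {G : C}
    (c c' a : Quotients G) (hcc : c ≤ c') (hca : c ≤ a) (hcompl : IntervalCompl c c') :
    c' ≤ radicalEl a := by
  have har : a ≤ radicalEl a := aux_rad a (by simp)
  have hcov : ∀ X, a ⋖ X → X ≤ radicalEl a := fun X hX => aux_rad a (by simp [hX])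
  generalize radicalEl a = r at har hcov
  have hsup_l : ∀ x y : Quotients G, x ≤ qSup x y := fun x y => (aux_qSup hC x y).1 (by simp)
  have hsup_r : ∀ x y : Quotients G, y ≤ qSup x y := fun x y => (aux_qSup hC x y).1 (by simp)
  have hsup_le : ∀ x y z : Quotients G, x ≤ z → y ≤ z → qSup x y ≤ z :=
    fun x y z h1 h2 => (aux_qSup hC x y).2 (by simp [upperBounds, h1, h2])
  have hinf_l : ∀ x y : Quotients G, qInf x y ≤ x := fun x y => (aux_qInf hC x y).1 (by simp)
  have hinf_r : ∀ x y : Quotients G, qInf x y ≤ y := fun x y => (aux_qInf hC x y).1 (by simp)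
  have hle_inf : ∀ x y z : Quotients G, z ≤ x → z ≤ y → z ≤ qInf x y :=
    fun x y z h1 h2 => (aux_qInf hC x y).2 (by simp [lowerBounds, h1, h2])
  obtain ⟨Y, hcY, hYc', hsup, hinf⟩ := hcompl (qInf r c') (hle_inf _ _ _ (hca.trans har) hcc)
    (hinf_r _ _)
  have hYr : ∀ z : Quotients G, z ≤ Y → z ≤ r → z ≤ c := fun z h1 h2 => by
    rw [← hinf]
    exact hle_inf _ _ _ (hle_inf _ _ _ h2 (h1.trans hYc')) h1
  by_cases hYa : Y ≤ a
  · rw [← hsup]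
    exact hsup_le _ _ _ (hinf_l _ _) (hYa.trans har)
  · exfalso
    have hlt : a < qSup a Y := lt_of_le_of_ne (hsup_l _ _) fun h => hYa (h ▸ hsup_r a Y)
    haveI := hC.quotFinite G
    obtain ⟨Z, hZ⟩ := (Set.toFinite {Z : Quotients G | a < Z ∧ Z ≤ qSup a Y}).exists_minimal
      ⟨_, hlt, le_rfl⟩
    have hZcov : a ⋖ Z := ⟨hZ.1.1, fun w h1 h2 =>
      absurd (hZ.2 ⟨h1, h2.le.trans hZ.1.2⟩ h2.le) (not_le_of_gt h2)⟩
    have h1 : Z ≤ qInf (qSup a Y) r := hle_inf _ _ _ hZ.1.2 (hcov Z hZcov)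
    rw [← hC.modular G a r Y har] at h1
    have h2 : Z ≤ a := h1.trans
      (hsup_le _ _ _ le_rfl ((hYr _ (hinf_l _ _) (hinf_r _ _)).trans hca))
    exact absurd h2 (not_le_of_gt hZ.1.1)

end MomentCat

open MomentCat in
/-- Lemma 4.17: in a formation `W` of finite complexity `k`,
given semisimple epimorphisms `ρᵢ : Rᵢ → Rᵢ₋₁` between objects of `W` and an
epimorphism `φ : F → R_k` with `F ∈ W`, if `φ, ρ_k, …, ρ₁` is a radical
sequence then `φ` is an isomorphism.  Here `ψ i : F ⟶ R i` denotes the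
composite `ρ_{i+1} ∘ ⋯ ∘ ρ_k ∘ φ`. -/
theorem statement15 {C : Type u} [SmallCategory C] (hC : IsDiamond C)
    (W : Set C) (hW : IsFormation W) (k : ℕ)
    (hWk : ∀ G ∈ W, complexityLE G k)
    (R : Fin (k + 1) → C) (hR : ∀ i, R i ∈ W)
    (ρ : ∀ i : Fin k, R i.succ ⟶ R i.castSucc)
    (hρe : ∀ i : Fin k, Epi (ρ i)) (hρss : ∀ i : Fin k, IsSemisimpleEpi (ρ i))
    (F : C) (hF : F ∈ W)
    (φ : F ⟶ R (Fin.last k)) (hφ : Epi φ)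
    (ψ : ∀ i : Fin (k + 1), F ⟶ R i) (hψe : ∀ i, Epi (ψ i))
    (hψlast : ψ (Fin.last k) = φ)
    (hψcomp : ∀ i : Fin k, ψ i.castSucc = ψ i.succ ≫ ρ i)
    (hrad : ∀ i : Fin k,
      quotOf (ψ i.succ) (hψe i.succ) = radicalEl (quotOf (ψ i.castSucc) (hψe i.castSucc))) :
    IsIso φ := by
  obtain ⟨c, hc0, hck, hc⟩ := hWk F hF
  have key : ∀ i : Fin (k + 1), c i ≤ quotOf (ψ i) (hψe i) := by
    intro i
    induction i using Fin.induction with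
    | zero => rw [hc0]; exact aux_bot hC _
    | succ i ih =>
      rw [hrad i]
      exact aux_step hC _ _ _ (hc i).1 ih (hc i).2
  have h := key (Fin.last k)
  rw [hck, top_le_iff] at h
  subst hψlast
  haveI := hψe (Fin.last k)
  have h2 : IsIso (ψ (Fin.last k)).op := (Subobject.isIso_iff_mk_eq_top _).2 h
  exact (isIso_op_iff _).1 h2
end

section
/- Let C be a diamond category and let W₀ ⊆ W₁ ⊆ ⋯ be an increasing chain of formations. Let G_i (i ∈ ℕ) be objects of C such that for all j ≥ i, the W_i-quotient satisfies G_j^{W_i} ≅ G_i. Then for any narrow formation W of finite complexity, there exists N such that for all i, j ≥ N, G_i^W ≅ G_j^W. -/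
open CategoryTheory Opposite Filter Topology MeasureTheory
open scoped ENNReal Classical

universe u

namespace MomentCat

variable {C : Type u} [SmallCategory C]

/-- `F` is (the target of) a quotient of `G`. -/
def HasEpi (G F : C) : Prop := ∃ π : G ⟶ F, Epi π

theorem HasEpi.trans {G F E : C} (h : HasEpi G F) (h' : HasEpi F E) : HasEpi G E := by
  obtain ⟨p, hp⟩ := h
  obtain ⟨q, hq⟩ := h'
  exact ⟨p ≫ q, epiComp hp hq⟩

theorem HasEpi.of_iso {G F : C} (e : G ≅ F) : HasEpi G F := ⟨e.hom, inferInstance⟩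

theorem HasEpi.mem {S : Set C} (hS : IsFormation S) {G F : C} (h : HasEpi G F) (hG : G ∈ S) :
    F ∈ S := by
  obtain ⟨p, hp⟩ := h
  exact hS.1 G hG F p hp

/-- The projection to a quotient. -/
noncomputable def qProj {G : C} (a : Quotients G) : G ⟶ qObj a :=
  (Subobject.arrow a).unop

instance qProj_epi {G : C} (a : Quotients G) : Epi (qProj a) := by
  have h : Epi (Subobject.arrow a).unop := unop_epi_of_mono _
  exact h

theorem quotOf_qProj {G : C} (a : Quotients G) : quotOf (qProj a) (qProj_epi a) = a :=
  Subobject.mk_arrow a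

theorem hasEpi_qObj {G : C} (a : Quotients G) : HasEpi G (qObj a) := ⟨qProj a, inferInstance⟩

theorem exists_fac_of_le {G : C} {a b : Quotients G} (h : a ≤ b) :
    ∃ f : qObj b ⟶ qObj a, Epi f ∧ qProj b ≫ f = qProj a := by
  refine ⟨(Subobject.ofLE a b h).unop, unop_epi_of_mono (Subobject.ofLE a b h), ?_⟩
  exact congrArg Quiver.Hom.unop (Subobject.ofLE_arrow h)

theorem hasEpi_of_le {G : C} {a b : Quotients G} (h : a ≤ b) : HasEpi (qObj b) (qObj a) := by
  obtain ⟨f, hf, -⟩ := exists_fac_of_le h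
  exact ⟨f, hf⟩

theorem exists_quot {G F : C} (h : HasEpi G F) : ∃ b : Quotients G, Nonempty (qObj b ≅ F) := by
  obtain ⟨p, hp⟩ := h
  exact ⟨Subobject.mk p.op, ⟨(Subobject.underlyingIso p.op).symm.unop⟩⟩

theorem qSup_isLUB (hC : IsDiamond C) {G : C} (a b : Quotients G) : IsLUB {a, b} (qSup a b) := by
  have h := hC.lub G a b
  unfold qSup
  rw [dif_pos h]
  exact h.choose_spec

theorem qInf_isGLB (hC : IsDiamond C) {G : C} (a b : Quotients G) : IsGLB {a, b} (qInf a b) := by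
  have h := hC.glb G a b
  unfold qInf
  rw [dif_pos h]
  exact h.choose_spec

theorem qBot_le (hC : IsDiamond C) {G : C} (x : Quotients G) : qBot G ≤ x := by
  have h : ∃ b : Quotients G, ∀ x, b ≤ x := by
    haveI := hC.quotFinite G
    obtain ⟨m, hm⟩ := (Set.toFinite (Set.univ : Set (Quotients G))).exists_minimal ⟨⊤, trivial⟩
    refine ⟨m, fun x => ?_⟩
    have hg := qInf_isGLB hC m x
    have h1 : qInf m x ≤ m := hg.1 (by simp)
    have h2 : qInf m x ≤ x := hg.1 (by simp)
    exact (hm.2 trivial h1).trans h2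
  unfold qBot
  rw [dif_pos h]
  exact h.choose_spec x

theorem map_arrow_le {G : C} (a : Quotients G) (y : Quotients (qObj a)) :
    (Subobject.map (Subobject.arrow a)).obj y ≤ a := by
  have h := (Subobject.map (Subobject.arrow a)).monotone (le_top : y ≤ ⊤)
  have h2 : (Subobject.map (Subobject.arrow a)).obj ⊤ = a :=
    (Subobject.map_top (Subobject.arrow a)).trans (Subobject.mk_arrow a)
  exact h.trans h2.le

theorem qBot_minimal (hC : IsDiamond C) (G : C) : IsMinimalObj (qObj (qBot G)) := by
  constructor
  intro y z
  apply Subobject.map_obj_injective (Subobject.arrow (qBot G))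
  rw [le_antisymm (map_arrow_le _ y) (qBot_le hC _), le_antisymm (map_arrow_le _ z) (qBot_le hC _)]

theorem wQuot_spec (hC : IsDiamond C) {S : Set C} (hS : IsFormation S) (G : C) :
    qObj (wQuot S G) ∈ S ∧ ∀ a : Quotients G, qObj a ∈ S → a ≤ wQuot S G := by
  haveI := hC.quotFinite G
  obtain ⟨m, hm⟩ := (Set.toFinite {a : Quotients G | qObj a ∈ S}).exists_maximal
    ⟨qBot G, hS.2.2 _ (qBot_minimal hC G)⟩
  have hgr : IsGreatest {a : Quotients G | qObj a ∈ S} m := by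
    refine ⟨hm.1, fun b hb => ?_⟩
    have hl := qSup_isLUB hC m b
    have hmem := hS.2.1 G m b hm.1 hb (hC.lub G m b)
    exact (hl.1 (by simp)).trans (hm.2 hmem (hl.1 (by simp)))
  have h : ∃ c, IsLUB {a : Quotients G | qObj a ∈ S} c := ⟨m, hgr.isLUB⟩
  have hw : wQuot S G = m := by
    unfold wQuot qsSup
    rw [dif_pos h]
    exact h.choose_spec.unique hgr.isLUB
  rw [hw]
  exact hgr

theorem hasEpi_wQuot (hC : IsDiamond C) {S : Set C} (hS : IsFormation S) {G F : C}
    (h : HasEpi G F) (hF : F ∈ S) : HasEpi (qObj (wQuot S G)) F := by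
  obtain ⟨b, ⟨e⟩⟩ := exists_quot h
  exact (hasEpi_of_le ((wQuot_spec hC hS G).2 b ((HasEpi.of_iso e.symm).mem hS hF))).trans
    (HasEpi.of_iso e)

theorem isIso_of_quotOf_top {G F : C} (p : G ⟶ F) (hp : Epi p) (h : quotOf p hp = ⊤) :
    IsIso p := by
  haveI : IsIso p.op := (Subobject.isIso_iff_mk_eq_top p.op).2 h
  exact (isIso_op_iff p).1 this

theorem isIso_of_epi_endo (hC : IsDiamond C) {H : C} (e : H ⟶ H) (he : Epi e) : IsIso e := by
  haveI := hC.quotFinite H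
  obtain ⟨y, hy⟩ := Finite.surjective_of_injective (Subobject.map_obj_injective e.op)
    (⊤ : Quotients H)
  apply isIso_of_quotOf_top e he
  apply top_le_iff.1
  have h := (Subobject.map e.op).monotone (le_top : y ≤ ⊤)
  rw [Subobject.map_top] at h
  rw [← hy]
  exact h

theorem iso_of_hasEpi (hC : IsDiamond C) {H K : C} (h : HasEpi H K) (h' : HasEpi K H) :
    Nonempty (H ≅ K) := by
  obtain ⟨f, hf⟩ := h
  obtain ⟨g, hg⟩ := h'
  haveI := isIso_of_epi_endo hC (f ≫ g) (epiComp hf hg)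
  haveI : IsSplitMono f := ⟨⟨⟨g ≫ inv (f ≫ g), by
    rw [← Category.assoc, IsIso.hom_inv_id]⟩⟩⟩
  haveI : IsIso f := isIso_of_epi_of_isSplitMono f
  exact ⟨asIso f⟩

theorem isSimpleEpi_of_covBy {H A B : C} (p : H ⟶ A) (hp : Epi p) (f : A ⟶ B) (hf : Epi f)
    (h : quotOf (p ≫ f) (epiComp hp hf) ⋖ quotOf p hp) : IsSimpleEpi f := by
  haveI := epiComp hp hf
  have key : (Subobject.map p.op).obj (quotOf f hf) = quotOf (p ≫ f) (epiComp hp hf) := by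
    unfold quotOf
    rw [Subobject.map_mk]
    rfl
  have ktop : (Subobject.map p.op).obj (⊤ : Quotients A) = quotOf p hp := Subobject.map_top p.op
  refine ⟨hf, ?_, ?_⟩
  · intro hiso
    have ht : quotOf f hf = ⊤ := (Subobject.isIso_iff_mk_eq_top f.op).1 inferInstance
    rw [← key, ht, ktop] at h
    exact h.lt.ne rfl
  · intro X hX
    have h1 := (Subobject.map p.op).monotone hX
    have h2 := (Subobject.map p.op).monotone (le_top : X ≤ ⊤)
    rw [key] at h1
    rw [ktop] at h2
    rcases h.eq_or_eq h1 h2 with h3 | h3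
    · left
      exact Subobject.map_obj_injective p.op (h3.trans key.symm)
    · right
      exact Subobject.map_obj_injective p.op (h3.trans ktop.symm)

theorem quotOf_comp_iso {G F E : C} (p : G ⟶ F) (hp : Epi p) (e : F ≅ E)
    (h : Epi (p ≫ e.hom)) : quotOf (p ≫ e.hom) h = quotOf p hp := by
  unfold quotOf
  exact Subobject.mk_eq_mk_of_comm _ _ e.op (by simp)

theorem quotOf_congr {G F : C} {p q : G ⟶ F} (hp : Epi p) (hq : Epi q) (h : p = q) :
    quotOf p hp = quotOf q hq := by
  subst h; rfl

theorem exists_simple {H A B : C} {a x : Quotients H} (hax : a ⋖ x) (e : qObj x ≅ A)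
    (e' : qObj a ≅ B) : ∃ f : A ⟶ B, IsSimpleEpi f := by
  obtain ⟨f, hf, hfac⟩ := exists_fac_of_le hax.le
  have hp : Epi (qProj x ≫ e.hom) := inferInstance
  have hf' : Epi (e.inv ≫ f ≫ e'.hom) := inferInstance
  refine ⟨e.inv ≫ f ≫ e'.hom, isSimpleEpi_of_covBy (qProj x ≫ e.hom) hp _ hf' ?_⟩
  have h1 : quotOf (qProj x ≫ e.hom) hp = x := by
    rw [quotOf_comp_iso (qProj x) inferInstance e hp, quotOf_qProj]
  have hc : (qProj x ≫ e.hom) ≫ e.inv ≫ f ≫ e'.hom = qProj a ≫ e'.hom := by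
    simp [← hfac]
  have h2 : quotOf ((qProj x ≫ e.hom) ≫ e.inv ≫ f ≫ e'.hom) (epiComp hp hf') = a := by
    rw [quotOf_congr (epiComp hp hf') inferInstance hc,
      quotOf_comp_iso (qProj a) inferInstance e' inferInstance, quotOf_qProj]
  rw [h1, h2]
  exact hax

/-- If all covers of `a` below `b` lie in the formation `S`, and `[a, b]` is complemented,
then `b` lies in `S`. -/
theorem mem_of_atoms (hC : IsDiamond C) {S : Set C} (hS : IsFormation S) {H : C}
    {a b : Quotients H} (hab : a ≤ b) (hc : IntervalCompl a b) (ha : qObj a ∈ S)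
    (hat : ∀ x : Quotients H, a ⋖ x → x ≤ b → qObj x ∈ S) : qObj b ∈ S := by
  haveI := hC.quotFinite H
  obtain ⟨s, hs⟩ := (Set.toFinite {x : Quotients H | a ≤ x ∧ x ≤ b ∧ qObj x ∈ S}).exists_maximal
    ⟨a, le_rfl, hab, ha⟩
  obtain ⟨has, hsb, hsS⟩ := hs.1
  obtain ⟨y, hay, hyb, hsup, hinf⟩ := hc s has hsb
  have hl := qSup_isLUB hC s y
  have hg := qInf_isGLB hC s y
  rw [hsup] at hl
  rw [hinf] at hg
  by_cases hya : a = y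
  · subst hya
    have : b ≤ s := hl.2 (by rintro z (rfl | rfl) <;> [exact le_rfl; exact has])
    rwa [le_antisymm this hsb]
  · obtain ⟨z, hz⟩ := (Set.toFinite {x : Quotients H | a < x ∧ x ≤ y}).exists_minimal
      ⟨y, lt_of_le_of_ne hay hya, le_rfl⟩
    have haz : a ⋖ z := ⟨hz.1.1, fun w haw hwz =>
      hwz.not_ge (hz.2 ⟨haw, hwz.le.trans hz.1.2⟩ hwz.le)⟩
    have hzb := hz.1.2.trans hyb
    have hzS := hat z haz hzb
    have hl' := qSup_isLUB hC s z
    have hmem := hS.2.1 H s z hsS hzS (hC.lub H s z)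
    have hsz : s ≤ qSup s z := hl'.1 (by simp)
    have hszb : qSup s z ≤ b := hl'.2 (by rintro w (rfl | rfl) <;> assumption)
    have hle := hs.2 ⟨has.trans hsz, hszb, hmem⟩ hsz
    have hzs : z ≤ s := (hl'.1 (by simp)).trans hle
    have : z ≤ a := hg.2 (by
      rintro w (rfl | rfl)
      · exact hzs
      · exact hz.1.2)
    exact absurd haz.lt this.not_gt

end MomentCat

open MomentCat in
/-- Lemma 5.2: given an increasing chain of formations
`W₀ ⊆ W₁ ⊆ ⋯` and objects `Gᵢ` with `G_j^{W_i} ≅ G_i` for all `j ≥ i`, for any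
narrow formation `V` of finite complexity there is `N` such that
`G_i^V ≅ G_j^V` for all `i, j ≥ N`. -/
theorem statement18 {C : Type u} [SmallCategory C] (hC : IsDiamond C)
    (W : ℕ → Set C) (hWf : ∀ i : ℕ, IsFormation (W i))
    (hmono : ∀ i j : ℕ, i ≤ j → W i ⊆ W j)
    (G : ℕ → C)
    (hG : ∀ i j : ℕ, i ≤ j → Nonempty (qObj (wQuot (W i) (G j)) ≅ G i))
    (V : Set C) (hV : IsFormation V) (hVn : Narrow V)
    (hVc : ∃ k : ℕ, ∀ H ∈ V, complexityLE H k) :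
    ∃ N : ℕ, ∀ i j : ℕ, N ≤ i → N ≤ j →
      Nonempty (qObj (wQuot V (G i)) ≅ qObj (wQuot V (G j))) := by
  obtain ⟨K, hK⟩ := hVc
  have hGW : ∀ i, G i ∈ W i := fun i => by
    obtain ⟨e⟩ := hG i i le_rfl
    exact (HasEpi.of_iso e).mem (hWf i) (wQuot_spec hC (hWf i) (G i)).1
  have hGG : ∀ i j, i ≤ j → HasEpi (G j) (G i) := fun i j hij => by
    obtain ⟨e⟩ := hG i j hij
    exact (hasEpi_qObj _).trans (HasEpi.of_iso e)
  have hdown : ∀ i N F, HasEpi (G i) F → F ∈ W N → HasEpi (G N) F := by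
    intro i N F h hF
    rcases le_total i N with hiN | hiN
    · exact (hGG i N hiN).trans h
    · obtain ⟨e⟩ := hG N i hiN
      exact (HasEpi.of_iso e.symm).trans (hasEpi_wQuot hC (hWf N) h hF)
  have hHV : ∀ i, qObj (wQuot V (G i)) ∈ V := fun i => (wQuot_spec hC hV (G i)).1
  choose c hc0 hcl hcs using fun i => hK _ (hHV i)
  have main : ∀ k (hk : k < K + 1), ∃ N, ∀ i, qObj (c i ⟨k, hk⟩) ∈ W N := by
    intro k
    induction k with
    | zero =>
      intro hk
      refine ⟨0, fun i => ?_⟩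
      have : c i ⟨0, hk⟩ = qBot _ := hc0 i
      rw [this]
      exact (hWf 0).2.2 _ (qBot_minimal hC _)
    | succ k ih =>
      intro hk
      obtain ⟨N, hN⟩ := ih (by omega)
      haveI := hC.quotFinite (G N)
      let T : Set (IsoCls C) := ⋃ b ∈ {b : Quotients (G N) | qObj b ∈ V},
        {X : IsoCls C | X.out ∈ V ∧ ∃ π : X.out ⟶ qObj b, IsSimpleEpi π}
      have hT : T.Finite := (Set.toFinite _).biUnion fun b hb => hVn _ hb
      have hM : ∃ M, N ≤ M ∧ ∀ X ∈ T, (∃ i, X.out ∈ W i) → X.out ∈ W M := by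
        have hch : ∀ X : IsoCls C, ∃ m, (∃ i, X.out ∈ W i) → X.out ∈ W m := fun X => by
          by_cases h : ∃ i, X.out ∈ W i
          · exact ⟨h.choose, fun _ => h.choose_spec⟩
          · exact ⟨0, fun h' => absurd h' h⟩
        choose m hm using hch
        refine ⟨N ⊔ hT.toFinset.sup m, le_sup_left, fun X hX h => ?_⟩
        exact hmono (m X) _ ((Finset.le_sup (f := m) (hT.mem_toFinset.2 hX)).trans le_sup_right)
          (hm X h)
      obtain ⟨M, hNM, hM⟩ := hM
      refine ⟨M, fun i => ?_⟩
      have hstep := hcs i ⟨k, by omega⟩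
      refine mem_of_atoms hC (hWf M) (a := c i ⟨k, by omega⟩) hstep.1 hstep.2
        (hmono N M hNM (hN i)) ?_
      intro x hax _
      obtain ⟨b, ⟨e⟩⟩ := exists_quot
        (hdown i N _ ((hasEpi_qObj (wQuot V (G i))).trans (hasEpi_qObj _)) (hN i))
      have hxV : qObj x ∈ V := (hasEpi_qObj x).mem hV (hHV i)
      have hbV : qObj b ∈ V :=
        ((hasEpi_qObj _).trans (HasEpi.of_iso e.symm)).mem hV (hHV i)
      have hout : Nonempty ((cls (qObj x)).out ≅ qObj x) :=
        Quotient.mk_out (s := CategoryTheory.isIsomorphicSetoid C) (qObj x)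
      obtain ⟨e2⟩ := hout
      have hxT : cls (qObj x) ∈ T := by
        refine Set.mem_biUnion (x := b) hbV ⟨(HasEpi.of_iso e2.symm).mem hV hxV, ?_⟩
        exact exists_simple hax e2.symm e.symm
      have hxi : qObj x ∈ W i :=
        ((hasEpi_qObj (wQuot V (G i))).trans (hasEpi_qObj x)).mem (hWf i) (hGW i)
      exact (HasEpi.of_iso e2).mem (hWf M)
        (hM _ hxT ⟨i, (HasEpi.of_iso e2.symm).mem (hWf i) hxi⟩)
  obtain ⟨N, hN⟩ := main K (by omega)
  have hiso : ∀ i, N ≤ i → Nonempty (qObj (wQuot V (G i)) ≅ qObj (wQuot V (G N))) := by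
    intro i hi
    have hW : qObj (wQuot V (G i)) ∈ W N := by
      have h := hN i
      have ht : c i ⟨K, by omega⟩ = ⊤ := hcl i
      rw [ht] at h
      obtain ⟨f, hf⟩ : ∃ f : qObj (⊤ : Quotients (qObj (wQuot V (G i)))) ⟶
          qObj (wQuot V (G i)), IsIso f :=
        ⟨inv (qProj (⊤ : Quotients (qObj (wQuot V (G i))))) (I := isIso_of_quotOf_top _
          inferInstance (quotOf_qProj _)), inferInstance⟩
      exact HasEpi.mem (hWf N) ⟨f, inferInstance⟩ h
    apply iso_of_hasEpi hC
    · exact hasEpi_wQuot hC hV ((hGG N i hi).trans (hasEpi_qObj _)) (hHV N)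
    · exact hasEpi_wQuot hC hV (hdown i N _ (hasEpi_qObj _) hW) (hHV i)
  refine ⟨N, fun i j hi hj => ?_⟩
  obtain ⟨e⟩ := hiso i hi
  obtain ⟨e'⟩ := hiso j hj
  exact ⟨e ≪≫ e'.symm⟩
end
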